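/- Let S = (s_n)_{n=1}^∞ be the binary sequence over 𝔽₂ defined by the polynomial Liouville function over 𝔽₂ via ℓ(n) = (-1)^{s_n} for n ≥ 1, where ℓ(n) = λ(F_n) and F_n(X) = ∑_{j=1}^r n_j X^{j-1} for the binary digits n_j of n. Then ⌊N/2⌋ ≤ L(S,N) ≤ ⌊N/2⌋ + 1 for all N ≥ 1. -/

import Mathlib

open scoped BigOperators

/-- The sequence `(s_n)` passes the `S`-dimensional `N`-lattice test if the vectors
`(s_n - s_1, s_{n+1} - s_2, …, s_{n+S-1} - s_S)`, `n = 2, 3, …, N - S + 1`,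
span `𝔽₂^S`. -/
def passesLatticeTest (s : ℕ → ZMod 2) (N S : ℕ) : Prop :=
  Submodule.span (ZMod 2)
      {v : Fin S → ZMod 2 |
        ∃ n : ℕ, 2 ≤ n ∧ n ≤ N - S + 1 ∧
          v = fun i : Fin S => s (n + (i : ℕ)) - s (1 + (i : ℕ))} = ⊤

/-- The `N`th lattice level: the greatest positive `S` such that the sequence passes the
`S`-dimensional `N`-lattice test (and `0` if there is no such `S`). -/
noncomputable def latticeLevel (s : ℕ → ZMod 2) (N : ℕ) : ℕ :=
  sSup {S : ℕ | 0 < S ∧ passesLatticeTest s N S}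

/-- The `N`th linear complexity: the smallest `L` such that
`s_{n+L} = c_{L-1} s_{n+L-1} + … + c_0 s_n` for `n = 1, …, N - L` and some fixed
`c_0, …, c_{L-1} ∈ 𝔽₂`.  (The conventions `L = 0` for the zero segment and `L = N` for
`s_1 = … = s_{N-1} = 0`, `s_N = 1` are automatic: for `L = 0` the condition reads
`s_n = 0` for `1 ≤ n ≤ N`, and for `L = N` it is vacuous.) -/
noncomputable def linComplexity (s : ℕ → ZMod 2) (N : ℕ) : ℕ :=
  sInf {L : ℕ | ∃ c : Fin L → ZMod 2,
    ∀ n : ℕ, 1 ≤ n → n + L ≤ N → s (n + L) = ∑ i : Fin L, c i * s (n + (i : ℕ))}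

/-- The polynomial Liouville function over `𝔽₂`: `λ(F) = (-1)^{∑ a_j}` where
`F = ∏ I_j^{a_j}` is the factorization into distinct monic irreducibles (so the
exponent is the number of irreducible factors counted with multiplicity);
`λ` of a nonzero constant is `1`. -/
noncomputable def polyLiouville (F : Polynomial (ZMod 2)) : ℤ :=
  (-1) ^ (Multiset.card (UniqueFactorizationMonoid.normalizedFactors F))

/-- The polynomial `F_n(X) = ∑_j n_j X^{j-1}` attached to the binary digits of `n`. -/
noncomputable def Fpoly (n : ℕ) : Polynomial (ZMod 2) :=
  ∑ j ∈ Finset.range n, if n.testBit j then Polynomial.X ^ j else 0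

/-- The arithmetic function `ℓ(n) = λ(F_n)` attached to the polynomial Liouville
function over `𝔽₂`. -/
noncomputable def polyLiouvilleSeq (n : ℕ) : ℤ := polyLiouville (Fpoly n)

open Polynomial in
theorem Fpoly_coeff (n j : ℕ) :
    (Fpoly n).coeff j = if n.testBit j then 1 else 0 := by
  have hterm : ∀ k, (if n.testBit k then (X : (ZMod 2)[X]) ^ k else 0).coeff j =
      if k = j then (if n.testBit j then 1 else 0) else 0 := by
    intro k
    by_cases hkj : k = j
    · subst hkj
      cases n.testBit k <;> simp
    · split_ifs <;> simp [coeff_X_pow, Ne.symm hkj]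
  rw [Fpoly, finsetSum_coeff, Finset.sum_congr rfl fun k _ => hterm k,
    Finset.sum_ite_eq']
  by_cases hj : j ∈ Finset.range n
  · simp [hj]
  · have hle : n ≤ j := by simpa using hj
    have : n.testBit j = false :=
      Nat.testBit_lt_two_pow (hle.trans_lt Nat.lt_two_pow_self)
    simp [this]

theorem Fpoly_ne_zero {n : ℕ} (hn : 1 ≤ n) : Fpoly n ≠ 0 := by
  intro h
  have : n = 0 := by
    refine Nat.zero_of_testBit_eq_false fun j => ?_
    have hj := Fpoly_coeff n j
    by_contra hb
    simp [h, hb] at hj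
  omega

theorem Fpoly_two_mul (n : ℕ) : Fpoly (2 * n) = Polynomial.X * Fpoly n := by
  ext j
  cases j with
  | zero => simp [Fpoly_coeff]
  | succ j => simp [Fpoly_coeff, Polynomial.coeff_X_mul, Nat.testBit_succ]

theorem polyLiouville_X_mul {F : Polynomial (ZMod 2)} (hF : F ≠ 0) :
    polyLiouville (Polynomial.X * F) = -polyLiouville F := by
  rw [polyLiouville, polyLiouville,
    UniqueFactorizationMonoid.normalizedFactors_mul Polynomial.X_ne_zero hF,
    UniqueFactorizationMonoid.normalizedFactors_irreducible Polynomial.irreducible_X,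
    Multiset.card_add, Multiset.card_singleton, pow_add]
  ring

theorem eq_add_one_of_neg_one_pow_val_eq_neg :
    ∀ a b : ZMod 2, (-1 : ℤ) ^ a.val = -(-1) ^ b.val → a = b + 1 := by
  decide

/-- In characteristic two the off-diagonal terms of a Hankel quadratic form cancel. -/
theorem sum_sum_mul_hankel (c f : ℕ → ZMod 2) (k : ℕ) :
    ∑ i ∈ Finset.range k, c i * ∑ j ∈ Finset.range k, c j * f (i + j) =
      ∑ i ∈ Finset.range k, c i * f (2 * i) := by
  induction k with
  | zero => simp
  | succ k ih =>
    have hcross : ∑ i ∈ Finset.range k, c i * (c k * f (i + k)) =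
        c k * ∑ j ∈ Finset.range k, c j * f (k + j) := by
      rw [Finset.mul_sum]
      refine Finset.sum_congr rfl fun i _ => ?_
      rw [add_comm i k]
      ring
    have hsq : c k * c k = c k := (by decide : ∀ a : ZMod 2, a * a = a) _
    simp only [Finset.sum_range_succ, mul_add, Finset.sum_add_distrib, ih, hcross]
    rw [← mul_assoc (c k) (c k), hsq, ← two_mul k, add_assoc, ← add_assoc (c k * _),
      CharTwo.add_self_eq_zero, zero_add]

/-- The Hankel matrices of a sequence with `h 1 = 1` and `h (2n+1) = h (2n) + h n` have
trivial kernel. -/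
theorem hankel_kernel_trivial {h : ℕ → ZMod 2} (h_one : h 1 = 1)
    (h_rec : ∀ n, 1 ≤ n → h (2 * n + 1) = h (2 * n) + h n) (k : ℕ) (c : ℕ → ZMod 2)
    (hc : ∀ n < k, ∑ i ∈ Finset.range k, c i * h (n + 1 + i) = 0) :
    ∀ i < k, c i = 0 := by
  induction k generalizing c with
  | zero => intro i hi; omega
  | succ k ih =>
    have hodd : ∑ i ∈ Finset.range (k + 1), c i * h (2 * i + 1) = 0 := by
      rw [← sum_sum_mul_hankel c (fun n => h (n + 1))]
      refine Finset.sum_eq_zero fun i hi => ?_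
      have := hc i (Finset.mem_range.mp hi)
      simp only [add_right_comm i 1] at this
      rw [this, mul_zero]
    have heven : ∑ i ∈ Finset.range (k + 1), c i * h (2 * i) =
        c 0 * ∑ j ∈ Finset.range (k + 1), c j * h j := by
      rw [← sum_sum_mul_hankel c h, Finset.sum_range_succ']
      simp only [zero_add]
      rw [Finset.sum_eq_zero, zero_add]
      intro i hi
      rw [hc i (by have := Finset.mem_range.mp hi; omega), mul_zero]
    have htotal : ∑ i ∈ Finset.range (k + 1), c i * (h (2 * i + 1) + h (2 * i) + h i) =
        c 0 := by
      rw [Finset.sum_range_succ', Finset.sum_eq_zero, zero_add]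
      · simp [h_one, add_assoc, CharTwo.add_self_eq_zero]
      · intro i _
        rw [h_rec (i + 1) (by omega), add_assoc, CharTwo.add_self_eq_zero, mul_zero]
    simp only [mul_add, Finset.sum_add_distrib, hodd, heven, zero_add] at htotal
    obtain ⟨hc_zero, hsum⟩ := (by decide : ∀ a b : ZMod 2, a * b + b = a → a = 0 ∧ b = 0)
      _ _ htotal
    have hshift := ih (fun i => c (i + 1)) fun n hn => by
      have hrow : ∑ i ∈ Finset.range (k + 1), c i * h (n + i) = 0 := by
        rcases n with _ | n
        · simpa using hsum
        · exact hc n (by omega)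
      rw [Finset.sum_range_succ', hc_zero, zero_mul, add_zero] at hrow
      simpa only [add_assoc, add_comm 1] using hrow
    intro i hi
    rcases i with _ | i
    · exact hc_zero
    · exact hshift i (by omega)

theorem hankel_solvable {h : ℕ → ZMod 2} (h_one : h 1 = 1)
    (h_rec : ∀ n, 1 ≤ n → h (2 * n + 1) = h (2 * n) + h n) (k : ℕ) (b : Fin k → ZMod 2) :
    ∃ d : Fin k → ZMod 2, ∀ n : Fin k, ∑ i : Fin k, d i * h (n + 1 + i) = b n := by
  let M : Matrix (Fin k) (Fin k) (ZMod 2) := Matrix.of fun n i => h (n + 1 + i)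
  have hinj : Function.Injective M.mulVecLin := by
    rw [← LinearMap.ker_eq_bot, LinearMap.ker_eq_bot']
    intro d hd
    have hker := hankel_kernel_trivial h_one h_rec k
      (fun i => if hi : i < k then d ⟨i, hi⟩ else 0) fun n hn => by
        rw [Finset.sum_range]
        have := congrFun hd ⟨n, hn⟩
        simpa [M, Matrix.mulVec, dotProduct, mul_comm] using this
    ext i
    simpa using hker i i.isLt
  obtain ⟨d, hd⟩ := LinearMap.surjective_of_injective hinj b
  refine ⟨d, fun n => ?_⟩
  simpa [M, Matrix.mulVec, dotProduct, mul_comm] using congrFun hd n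

theorem stmt16 (s : ℕ → ZMod 2)
    (hs : ∀ n : ℕ, 1 ≤ n → polyLiouvilleSeq n = (-1) ^ (s n).val) :
    ∀ N : ℕ, 1 ≤ N →
      N / 2 ≤ linComplexity s N ∧ linComplexity s N ≤ N / 2 + 1 := by
  have s_two_mul : ∀ n, 1 ≤ n → s (2 * n) = s n + 1 := fun n hn => by
    refine eq_add_one_of_neg_one_pow_val_eq_neg _ _ ?_
    rw [← hs _ hn, ← hs _ (by omega), polyLiouvilleSeq, polyLiouvilleSeq, Fpoly_two_mul,
      polyLiouville_X_mul (Fpoly_ne_zero hn)]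
  obtain ⟨h, hh⟩ : ∃ h : ℕ → ZMod 2, ∀ n, h n = s n + s (n + 1) := ⟨_, fun _ => rfl⟩
  have h_one : h 1 = 1 := by
    rw [hh, show 1 + 1 = 2 * 1 from rfl, s_two_mul 1 le_rfl, ← add_assoc,
      CharTwo.add_self_eq_zero, zero_add]
  have h_rec : ∀ n, 1 ≤ n → h (2 * n + 1) = h (2 * n) + h n := fun n hn => by
    rw [hh, hh, hh, show 2 * n + 1 + 1 = 2 * (n + 1) by ring, s_two_mul n hn,
      s_two_mul (n + 1) (by omega)]
    generalize s (2 * n + 1) = x, s n = y, s (n + 1) = z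
    revert x y z
    decide
  intro N _
  have hupper : N / 2 + 1 ∈ {L : ℕ | ∃ c : Fin L → ZMod 2,
      ∀ n : ℕ, 1 ≤ n → n + L ≤ N → s (n + L) = ∑ i : Fin L, c i * s (n + (i : ℕ))} := by
    obtain ⟨d, hd⟩ := hankel_solvable h_one h_rec (N / 2)
      fun n => s (n + 1 + (N / 2 + 1))
    refine ⟨fun i => (Fin.snoc d 0 : Fin (N / 2 + 1) → ZMod 2) i +
      (Fin.cons 0 d : Fin (N / 2 + 1) → ZMod 2) i, fun n hn hnN => ?_⟩
    have hrow := hd ⟨n - 1, by omega⟩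
    simp only [Nat.sub_add_cancel hn, hh, mul_add, Finset.sum_add_distrib] at hrow
    simp only [add_mul, Finset.sum_add_distrib]
    rw [Fin.sum_univ_castSucc, Fin.sum_univ_succ (fun i => (Fin.cons 0 d :
      Fin (N / 2 + 1) → ZMod 2) i * _), ← hrow]
    simp [add_assoc]
  have hlower : ∀ L : ℕ, (∃ c : Fin L → ZMod 2,
      ∀ n : ℕ, 1 ≤ n → n + L ≤ N → s (n + L) = ∑ i : Fin L, c i * s (n + (i : ℕ))) →
      N / 2 ≤ L := by
    rintro L ⟨c, hc⟩
    by_contra! hlt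
    have hker := hankel_kernel_trivial h_one h_rec (L + 1)
      (fun i => if hi : i < L then c ⟨i, hi⟩ else 1) fun n hn => by
        have hrow := hc (n + 1) (by omega) (by omega)
        have hrow' := hc (n + 1 + 1) (by omega) (by omega)
        simp only [add_right_comm (n + 1) 1] at hrow'
        rw [Finset.sum_range_succ, Finset.sum_range]
        simp only [Fin.is_lt, Fin.eta, dite_true, lt_irrefl, dite_false, one_mul, hh,
          mul_add, Finset.sum_add_distrib]
        rw [hrow, hrow', CharTwo.add_self_eq_zero]
    simpa using hker L (by omega)
  exact ⟨hlower _ (Nat.sInf_mem ⟨_, hupper⟩), Nat.sInf_le hupper⟩
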